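/- Let Y be a real symmetric n×n matrix, D an n×p matrix, and E a q×n matrix. Then Y + D F E + Eᵀ Fᵀ Dᵀ < 0 (negative definite) for all p×q matrices F satisfying Fᵀ F ≤ I, if and only if there exists a scalar ε > 0 such that Y + ε D Dᵀ + ε⁻¹ Eᵀ E < 0. -/

import Mathlib

open Matrix

section QuadraticForms

variable {ι : Type*} [Fintype ι]

lemma smul_dotProduct_mulVec_smul (M : Matrix ι ι ℝ) (r : ℝ) (x : ι → ℝ) :
    (r • x) ⬝ᵥ M *ᵥ (r • x) = r ^ 2 * (x ⬝ᵥ M *ᵥ x) := by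
  simp only [mulVec_smul, dotProduct_smul, smul_dotProduct, smul_eq_mul]
  ring

lemma dotProduct_mulVec_linear_combination (M : Matrix ι ι ℝ) (r s : ℝ) (x z : ι → ℝ) :
    (r • x + s • z) ⬝ᵥ M *ᵥ (r • x + s • z) =
      r ^ 2 * (x ⬝ᵥ M *ᵥ x) + r * s * (x ⬝ᵥ M *ᵥ z + z ⬝ᵥ M *ᵥ x) +
        s ^ 2 * (z ⬝ᵥ M *ᵥ z) := by
  simp only [mulVec_add, mulVec_smul, dotProduct_add, add_dotProduct, dotProduct_smul,
    smul_dotProduct, smul_eq_mul]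
  ring

lemma continuous_dotProduct_mulVec_self (M : Matrix ι ι ℝ) :
    Continuous fun x : ι → ℝ => x ⬝ᵥ M *ᵥ x :=
  continuous_id.dotProduct (continuous_const.matrix_mulVec continuous_id)

lemma exists_dotProduct_mulVec_eq_zero_of_cross_nonneg (M N : Matrix ι ι ℝ) {x z : ι → ℝ}
    (hMx : 0 ≤ x ⬝ᵥ M *ᵥ x) (hMz : 0 ≤ z ⬝ᵥ M *ᵥ z)
    (hNx : x ⬝ᵥ N *ᵥ x < 0) (hNz : 0 < z ⬝ᵥ N *ᵥ z)
    (hcross : 0 ≤ x ⬝ᵥ M *ᵥ z + z ⬝ᵥ M *ᵥ x) :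
    ∃ w ≠ 0, 0 ≤ w ⬝ᵥ M *ᵥ w ∧ w ⬝ᵥ N *ᵥ w = 0 := by
  have hcont : Continuous fun t : ℝ =>
      ((1 - t) • x + t • z) ⬝ᵥ N *ᵥ ((1 - t) • x + t • z) :=
    (continuous_dotProduct_mulVec_self N).comp (by fun_prop)
  obtain ⟨t, ⟨ht0, ht1⟩, ht⟩ := intermediate_value_Icc (zero_le_one' ℝ) hcont.continuousOn
    (show (0 : ℝ) ∈ Set.Icc _ _ by simpa using ⟨hNx.le, hNz.le⟩)
  have hs : 0 ≤ 1 - t := sub_nonneg.2 ht1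
  refine ⟨(1 - t) • x + t • z, fun hw => ?_, ?_, ht⟩
  · have h := congrArg (fun v => v ⬝ᵥ N *ᵥ v) (eq_neg_of_add_eq_zero_left hw)
    simp only [← neg_smul, smul_dotProduct_mulVec_smul] at h
    have ht0' : t = 0 := by
      by_contra hne
      have : 0 < t ^ 2 * (z ⬝ᵥ N *ᵥ z) := by positivity
      nlinarith [mul_nonneg (sq_nonneg (1 - t)) (neg_nonneg.2 hNx.le)]
    subst ht0'
    norm_num at h
    exact hNx.ne h
  · rw [dotProduct_mulVec_linear_combination]
    positivity

lemma exists_dotProduct_mulVec_eq_zero (M N : Matrix ι ι ℝ) {x z : ι → ℝ}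
    (hx : x ≠ 0) (hz : z ≠ 0)
    (hMx : 0 ≤ x ⬝ᵥ M *ᵥ x) (hMz : 0 ≤ z ⬝ᵥ M *ᵥ z)
    (hNx : x ⬝ᵥ N *ᵥ x ≤ 0) (hNz : 0 ≤ z ⬝ᵥ N *ᵥ z) :
    ∃ w ≠ 0, 0 ≤ w ⬝ᵥ M *ᵥ w ∧ w ⬝ᵥ N *ᵥ w = 0 := by
  rcases hNx.eq_or_lt with hNx | hNx
  · exact ⟨x, hx, hMx, hNx⟩
  rcases hNz.eq_or_lt with hNz | hNz
  · exact ⟨z, hz, hMz, hNz.symm⟩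
  rcases le_total 0 (x ⬝ᵥ M *ᵥ z + z ⬝ᵥ M *ᵥ x) with hc | hc
  · exact exists_dotProduct_mulVec_eq_zero_of_cross_nonneg M N hMx hMz hNx hNz hc
  · refine exists_dotProduct_mulVec_eq_zero_of_cross_nonneg M N (z := -z) hMx ?_ hNx ?_ ?_ <;>
      simp only [mulVec_neg, dotProduct_neg, neg_dotProduct, neg_neg] <;> linarith

lemma isClosed_setOf_exists_sphere {f g : ℝ → (ι → ℝ) → ℝ}
    (hf : Continuous (Function.uncurry f)) (hg : Continuous (Function.uncurry g)) (u v : ℝ) :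
    IsClosed {r | r ∈ Set.Icc u v ∧
      ∃ x ∈ Metric.sphere (0 : ι → ℝ) 1, 0 ≤ f r x ∧ 0 ≤ g r x} := by
  have hK : IsCompact ((Set.Icc u v ×ˢ Metric.sphere (0 : ι → ℝ) 1) ∩
      ({p | 0 ≤ Function.uncurry f p} ∩ {p | 0 ≤ Function.uncurry g p})) :=
    (isCompact_Icc.prod (isCompact_sphere _ _)).inter_right
      ((isClosed_le continuous_const hf).inter (isClosed_le continuous_const hg))
  convert (hK.image continuous_fst).isClosed using 1
  ext r
  constructor
  · rintro ⟨hr, x, hx, h1, h2⟩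
    exact ⟨(r, x), ⟨⟨hr, hx⟩, h1, h2⟩, rfl⟩
  · rintro ⟨⟨r, x⟩, ⟨⟨hr, hx⟩, h1, h2⟩, rfl⟩
    exact ⟨hr, x, hx, h1, h2⟩

/-- If `A, B ≥ 0`, `Y < 0` and `(xᵀ Y x)² > 4 (xᵀ A x) (xᵀ B x)` for all `x ≠ 0`, then
`ε² A + ε Y + B < 0` for some `ε > 0`. -/
lemma exists_pos_forall_sq_mul_add_mul_add_neg (Y A B : Matrix ι ι ℝ)
    (hA : ∀ x, 0 ≤ x ⬝ᵥ A *ᵥ x) (hB : ∀ x, 0 ≤ x ⬝ᵥ B *ᵥ x)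
    (hY : ∀ x ≠ 0, x ⬝ᵥ Y *ᵥ x < 0)
    (hdisc : ∀ x ≠ 0, 4 * ((x ⬝ᵥ A *ᵥ x) * (x ⬝ᵥ B *ᵥ x)) < (x ⬝ᵥ Y *ᵥ x) ^ 2) :
    ∃ ε : ℝ, 0 < ε ∧ ∀ x ≠ 0,
      ε ^ 2 * (x ⬝ᵥ A *ᵥ x) + ε * (x ⬝ᵥ Y *ᵥ x) + x ⬝ᵥ B *ᵥ x < 0 := by
  by_contra! hcon
  set S := Metric.sphere (0 : ι → ℝ) 1 with hS
  have hne : ∀ x ∈ S, x ≠ 0 := fun x hx => ne_zero_of_mem_unit_sphere ⟨x, hx⟩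
  have hbad : ∀ ε : ℝ, 0 < ε → ∃ x ∈ S,
      0 ≤ ε ^ 2 * (x ⬝ᵥ A *ᵥ x) + ε * (x ⬝ᵥ Y *ᵥ x) + x ⬝ᵥ B *ᵥ x := by
    intro ε hε
    obtain ⟨x, hx, h⟩ := hcon ε hε
    refine ⟨‖x‖⁻¹ • x, by simp [hS, norm_smul, hx], ?_⟩
    simp only [smul_dotProduct_mulVec_smul]
    have := mul_nonneg (sq_nonneg ‖x‖⁻¹) h
    linarith
  have hSc : IsCompact S := isCompact_sphere _ _
  have hSn : S.Nonempty := (hbad 1 one_pos).imp fun _ h => h.1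
  obtain ⟨x₀, hx₀, hmax⟩ := hSc.exists_isMaxOn hSn
    (continuous_dotProduct_mulVec_self Y).continuousOn
  obtain ⟨x₁, -, hmaxA⟩ := hSc.exists_isMaxOn hSn
    (continuous_dotProduct_mulVec_self A).continuousOn
  obtain ⟨x₂, -, hmaxB⟩ := hSc.exists_isMaxOn hSn
    (continuous_dotProduct_mulVec_self B).continuousOn
  obtain ⟨c, hc, hYc⟩ : ∃ c : ℝ, 0 < c ∧ ∀ x ∈ S, x ⬝ᵥ Y *ᵥ x ≤ -c :=
    ⟨-(x₀ ⬝ᵥ Y *ᵥ x₀), neg_pos.2 (hY _ (hne _ hx₀)), fun x hx => by simpa using hmax hx⟩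
  obtain ⟨K, hcK, hAK, hBK⟩ : ∃ K : ℝ, c ≤ K ∧ (∀ x ∈ S, x ⬝ᵥ A *ᵥ x ≤ K) ∧
      ∀ x ∈ S, x ⬝ᵥ B *ᵥ x ≤ K :=
    ⟨c + x₁ ⬝ᵥ A *ᵥ x₁ + x₂ ⬝ᵥ B *ᵥ x₂, by linarith [hA x₁, hB x₂],
      fun x hx => by linarith [isMaxOn_iff.1 hmaxA x hx, hB x₂],
      fun x hx => by linarith [isMaxOn_iff.1 hmaxB x hx, hA x₁]⟩
  have hK : 0 < K := hc.trans_le hcK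
  set u := c / (2 * K) with hu
  set v := 2 * K / c with hv
  have hu0 : 0 < u := by positivity
  have hv0 : 0 < v := by positivity
  have huK : u * (2 * K) = c := by rw [hu]; field_simp
  have hvc : v * c = 2 * K := by rw [hv]; field_simp
  have huv : u ≤ v := by
    have h1 : u ≤ 1 := by rw [hu, div_le_one (by positivity)]; linarith
    have h2 : 1 ≤ v := by rw [hv, one_le_div hc]; linarith
    exact h1.trans h2
  let Q : ℝ → (ι → ℝ) → ℝ := fun r x =>
    r ^ 2 * (x ⬝ᵥ A *ᵥ x) + r * (x ⬝ᵥ Y *ᵥ x) + x ⬝ᵥ B *ᵥ x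
  let P : ℝ → (ι → ℝ) → ℝ := fun r x => r ^ 2 * (x ⬝ᵥ A *ᵥ x) - x ⬝ᵥ B *ᵥ x
  have hcomp : ∀ M : Matrix ι ι ℝ, Continuous fun p : ℝ × (ι → ℝ) => p.2 ⬝ᵥ M *ᵥ p.2 :=
    fun M => (continuous_dotProduct_mulVec_self M).comp continuous_snd
  have hQ : Continuous (Function.uncurry Q) :=
    (((continuous_fst.pow 2).mul (hcomp A)).add (continuous_fst.mul (hcomp Y))).add (hcomp B)
  have hP : Continuous (Function.uncurry P) :=
    ((continuous_fst.pow 2).mul (hcomp A)).sub (hcomp B)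
  have hcover : Set.Icc u v ⊆
      {r | r ∈ Set.Icc u v ∧ ∃ x ∈ S, 0 ≤ Q r x ∧ 0 ≤ (-P) r x} ∪
        {r | r ∈ Set.Icc u v ∧ ∃ x ∈ S, 0 ≤ Q r x ∧ 0 ≤ P r x} := by
    intro r hr
    obtain ⟨x, hx, h⟩ := hbad r (hu0.trans_le hr.1)
    rcases le_total (P r x) 0 with hp | hp
    · exact Or.inl ⟨hr, x, hx, h, neg_nonneg.2 hp⟩
    · exact Or.inr ⟨hr, x, hx, h, hp⟩
  obtain ⟨r, hr, ⟨-, x, hx, hQx, hPx⟩, -, z, hz, hQz, hPz⟩ :=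
    isPreconnected_closed_iff.1 isPreconnected_Icc _ _
      (isClosed_setOf_exists_sphere hQ (g := -P) hP.neg u v)
      (isClosed_setOf_exists_sphere hQ hP u v) hcover
      (by
        obtain ⟨x, hx, h⟩ := hbad u hu0
        refine ⟨u, ⟨le_rfl, huv⟩, ⟨le_rfl, huv⟩, x, hx, h, ?_⟩
        change 0 ≤ -(u ^ 2 * (x ⬝ᵥ A *ᵥ x) - x ⬝ᵥ B *ᵥ x)
        by_contra! hlt
        have h1 := mul_le_mul_of_nonneg_left (hYc x hx) hu0.le
        have h2 := mul_le_mul_of_nonneg_left (hAK x hx) (sq_nonneg u)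
        have h3 : u ^ 2 * K * 2 = u * c := by rw [← huK]; ring
        linarith)
      (by
        obtain ⟨x, hx, h⟩ := hbad v hv0
        refine ⟨v, ⟨huv, le_rfl⟩, ⟨huv, le_rfl⟩, x, hx, h, ?_⟩
        change 0 ≤ v ^ 2 * (x ⬝ᵥ A *ᵥ x) - x ⬝ᵥ B *ᵥ x
        by_contra! hlt
        have h1 := mul_le_mul_of_nonneg_left (hYc x hx) hv0.le
        have h2 := hBK x hx
        linarith)
  have hr0 : 0 < r := hu0.trans_le hr.1
  have hQM : ∀ w, w ⬝ᵥ (r ^ 2 • A + r • Y + B) *ᵥ w = Q r w := fun w => by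
    simp [Q, add_mulVec, smul_mulVec, dotProduct_add]
  have hPN : ∀ w, w ⬝ᵥ (r ^ 2 • A - B) *ᵥ w = P r w := fun w => by
    simp [P, sub_mulVec, smul_mulVec, dotProduct_sub]
  obtain ⟨w, hw, hQw, hPw⟩ := exists_dotProduct_mulVec_eq_zero
    (r ^ 2 • A + r • Y + B) (r ^ 2 • A - B) (hne x hx) (hne z hz)
    (by rwa [hQM]) (by rwa [hQM]) (by rw [hPN]; exact neg_nonneg.1 hPx) (by rwa [hPN])
  rw [hQM] at hQw
  rw [hPN] at hPw
  simp only [Q, P] at hQw hPw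
  have hYw := hY w hw
  have hb : w ⬝ᵥ B *ᵥ w = r ^ 2 * (w ⬝ᵥ A *ᵥ w) := by linarith
  have hd := hdisc w hw
  rw [hb] at hd hQw
  have h1 : -(w ⬝ᵥ Y *ᵥ w) ≤ 2 * (r * (w ⬝ᵥ A *ᵥ w)) := by
    refine le_of_mul_le_mul_left ?_ hr0
    linarith
  have h2 := pow_le_pow_left₀ (neg_pos.2 hYw).le h1 2
  linarith

end QuadraticForms

section RankOne

variable {κ μ : Type*} [Fintype κ] [Fintype μ]

lemma dotProduct_sq_le_dotProduct_self_mul (u v : κ → ℝ) :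
    (u ⬝ᵥ v) ^ 2 ≤ (u ⬝ᵥ u) * (v ⬝ᵥ v) := by
  simpa only [dotProduct, ← sq] using Finset.sum_mul_sq_le_sq_mul_sq Finset.univ u v

lemma real_dotProduct_self_nonneg (u : κ → ℝ) : 0 ≤ u ⬝ᵥ u :=
  Finset.sum_nonneg fun i _ => mul_self_nonneg (u i)

/-- The bilinear form `F ↦ uᵀ F v` attains the value `‖u‖ ‖v‖` on contractions. -/
lemma exists_contraction_dotProduct_mulVec_eq [DecidableEq μ] (u : κ → ℝ) (v : μ → ℝ) :
    ∃ F : Matrix κ μ ℝ, (1 - Fᵀ * F).PosSemidef ∧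
      u ⬝ᵥ F *ᵥ v = √((u ⬝ᵥ u) * (v ⬝ᵥ v)) := by
  set α := (u ⬝ᵥ u) * (v ⬝ᵥ v) with hα
  have hu := real_dotProduct_self_nonneg u
  have hv := real_dotProduct_self_nonneg v
  have hα0 : 0 ≤ α := mul_nonneg hu hv
  have hFw : ∀ w, ((√α)⁻¹ • vecMulVec u v) *ᵥ w = ((√α)⁻¹ * (v ⬝ᵥ w)) • u := fun w => by
    rw [smul_mulVec, vecMulVec_mulVec, op_smul_eq_smul, smul_smul]
  refine ⟨(√α)⁻¹ • vecMulVec u v, .of_dotProduct_mulVec_nonneg ?_ fun w => ?_, ?_⟩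
  · simp [IsHermitian, conjTranspose_eq_transpose_of_trivial]
  · rw [star_trivial, sub_mulVec, one_mulVec, dotProduct_sub, ← mulVec_mulVec,
      dotProduct_mulVec, vecMul_transpose, hFw, smul_dotProduct, dotProduct_smul,
      smul_eq_mul, smul_eq_mul, sub_nonneg]
    have hcs := dotProduct_sq_le_dotProduct_self_mul v w
    have hw := real_dotProduct_self_nonneg w
    have hle : ((√α)⁻¹) ^ 2 * α ≤ 1 := by
      rw [inv_pow, Real.sq_sqrt hα0]
      exact inv_mul_le_one
    calc _ = ((√α)⁻¹) ^ 2 * (u ⬝ᵥ u) * (v ⬝ᵥ w) ^ 2 := by ring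
      _ ≤ ((√α)⁻¹) ^ 2 * (u ⬝ᵥ u) * ((v ⬝ᵥ v) * (w ⬝ᵥ w)) := by gcongr
      _ = ((√α)⁻¹) ^ 2 * α * (w ⬝ᵥ w) := by rw [hα]; ring
      _ ≤ 1 * (w ⬝ᵥ w) := by gcongr
      _ = w ⬝ᵥ w := one_mul _
  · rw [hFw, dotProduct_smul, smul_eq_mul]
    calc _ = α / √α := by rw [hα]; ring
      _ = √α := Real.div_sqrt

lemma two_mul_dotProduct_mulVec_le {F : Matrix κ μ ℝ} [DecidableEq μ]
    (hF : (1 - Fᵀ * F).PosSemidef) {ε : ℝ} (hε : 0 < ε) (u : κ → ℝ) (v : μ → ℝ) :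
    2 * (u ⬝ᵥ F *ᵥ v) ≤ ε * (u ⬝ᵥ u) + ε⁻¹ * (v ⬝ᵥ v) := by
  have h1 := hF.dotProduct_mulVec_nonneg v
  rw [star_trivial, sub_mulVec, one_mulVec, dotProduct_sub, ← mulVec_mulVec,
    dotProduct_mulVec v, vecMul_transpose, sub_nonneg] at h1
  have h2 := real_dotProduct_self_nonneg (ε • u - F *ᵥ v)
  simp only [dotProduct_sub, sub_dotProduct, dotProduct_smul, smul_dotProduct,
    smul_eq_mul, dotProduct_comm (F *ᵥ v) u] at h2
  refine le_of_mul_le_mul_left ?_ hε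
  rw [mul_add, mul_inv_cancel_left₀ hε.ne']
  linarith

end RankOne

section Uncertainty

variable {ι κ μ : Type*} [Fintype ι] [Fintype κ] [Fintype μ]

lemma dotProduct_mul_transpose_mulVec (D : Matrix ι κ ℝ) (x : ι → ℝ) :
    x ⬝ᵥ (D * Dᵀ) *ᵥ x = (Dᵀ *ᵥ x) ⬝ᵥ (Dᵀ *ᵥ x) := by
  rw [← mulVec_mulVec, dotProduct_mulVec, mulVec_transpose]

lemma dotProduct_transpose_mul_mulVec (E : Matrix μ ι ℝ) (x : ι → ℝ) :
    x ⬝ᵥ (Eᵀ * E) *ᵥ x = (E *ᵥ x) ⬝ᵥ (E *ᵥ x) := by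
  rw [← mulVec_mulVec, dotProduct_mulVec, vecMul_transpose]

lemma dotProduct_uncertainty_mulVec (Y : Matrix ι ι ℝ) (D : Matrix ι κ ℝ) (E : Matrix μ ι ℝ)
    (F : Matrix κ μ ℝ) (x : ι → ℝ) :
    x ⬝ᵥ (Y + D * F * E + Eᵀ * Fᵀ * Dᵀ) *ᵥ x =
      x ⬝ᵥ Y *ᵥ x + 2 * ((Dᵀ *ᵥ x) ⬝ᵥ F *ᵥ (E *ᵥ x)) := by
  have h1 : x ⬝ᵥ (D * F * E) *ᵥ x = (Dᵀ *ᵥ x) ⬝ᵥ F *ᵥ (E *ᵥ x) := by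
    rw [← mulVec_mulVec, ← mulVec_mulVec, dotProduct_mulVec, mulVec_transpose]
  have h2 : x ⬝ᵥ (Eᵀ * Fᵀ * Dᵀ) *ᵥ x = (Dᵀ *ᵥ x) ⬝ᵥ F *ᵥ (E *ᵥ x) := by
    rw [← mulVec_mulVec, ← mulVec_mulVec, dotProduct_mulVec, vecMul_transpose,
      dotProduct_mulVec, vecMul_transpose, dotProduct_comm]
  rw [add_mulVec, add_mulVec, dotProduct_add, dotProduct_add, h1, h2]
  ring

lemma dotProduct_bound_mulVec (Y : Matrix ι ι ℝ) (D : Matrix ι κ ℝ) (E : Matrix μ ι ℝ)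
    (ε : ℝ) (x : ι → ℝ) :
    x ⬝ᵥ (Y + ε • (D * Dᵀ) + ε⁻¹ • (Eᵀ * E)) *ᵥ x =
      x ⬝ᵥ Y *ᵥ x + ε * ((Dᵀ *ᵥ x) ⬝ᵥ (Dᵀ *ᵥ x)) + ε⁻¹ * ((E *ᵥ x) ⬝ᵥ (E *ᵥ x)) := by
  simp only [add_mulVec, smul_mulVec, dotProduct_add, dotProduct_smul, smul_eq_mul,
    dotProduct_mul_transpose_mulVec, dotProduct_transpose_mul_mulVec]

lemma posDef_neg_iff_of_isSymm {M : Matrix ι ι ℝ} (hM : M.IsSymm) :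
    (-M).PosDef ↔ ∀ x ≠ 0, x ⬝ᵥ M *ᵥ x < 0 := by
  have hH : (-M).IsHermitian := by
    rw [IsHermitian, conjTranspose_eq_transpose_of_trivial]
    exact hM.neg
  rw [posDef_iff_dotProduct_mulVec, and_iff_right hH]
  simp [neg_mulVec]

end Uncertainty

/-- Petersen/Khargonekar uncertainty bounding lemma:
`Y + D F E + Eᵀ Fᵀ Dᵀ < 0` for all `F` with `Fᵀ F ≤ I` iff
there is `ε > 0` with `Y + ε D Dᵀ + ε⁻¹ Eᵀ E < 0`. -/
theorem stmt_0 (n p q : ℕ)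
    (Y : Matrix (Fin n) (Fin n) ℝ) (hY : Y.IsSymm)
    (D : Matrix (Fin n) (Fin p) ℝ) (E : Matrix (Fin q) (Fin n) ℝ) :
    (∀ F : Matrix (Fin p) (Fin q) ℝ, (1 - Fᵀ * F).PosSemidef →
      (-(Y + D * F * E + Eᵀ * Fᵀ * Dᵀ)).PosDef) ↔
    (∃ ε : ℝ, 0 < ε ∧ (-(Y + ε • (D * Dᵀ) + ε⁻¹ • (Eᵀ * E))).PosDef) := by
  have hsymmF : ∀ F : Matrix (Fin p) (Fin q) ℝ,
      (Y + D * F * E + Eᵀ * Fᵀ * Dᵀ).IsSymm := fun F => by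
    simp only [IsSymm, transpose_add, transpose_mul, transpose_transpose, hY.eq,
      Matrix.mul_assoc]
    abel
  have hsymm : ∀ ε : ℝ, (Y + ε • (D * Dᵀ) + ε⁻¹ • (Eᵀ * E)).IsSymm := fun ε => by
    simp [IsSymm, hY.eq]
  simp only [posDef_neg_iff_of_isSymm (hsymmF _), posDef_neg_iff_of_isSymm (hsymm _),
    dotProduct_uncertainty_mulVec, dotProduct_bound_mulVec]
  constructor
  · intro h
    have hsqrt : ∀ x ≠ 0, x ⬝ᵥ Y *ᵥ x +
        2 * √(((Dᵀ *ᵥ x) ⬝ᵥ (Dᵀ *ᵥ x)) * ((E *ᵥ x) ⬝ᵥ (E *ᵥ x))) < 0 := fun x hx => by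
      obtain ⟨F, hF, hFx⟩ := exists_contraction_dotProduct_mulVec_eq (Dᵀ *ᵥ x) (E *ᵥ x)
      rw [← hFx]
      exact h F hF x hx
    obtain ⟨ε, hε, hneg⟩ := exists_pos_forall_sq_mul_add_mul_add_neg Y (D * Dᵀ) (Eᵀ * E)
      (fun x => by
        rw [dotProduct_mul_transpose_mulVec]
        exact real_dotProduct_self_nonneg _)
      (fun x => by
        rw [dotProduct_transpose_mul_mulVec]
        exact real_dotProduct_self_nonneg _)
      (fun x hx => by
        have hs := Real.sqrt_nonneg (((Dᵀ *ᵥ x) ⬝ᵥ (Dᵀ *ᵥ x)) * ((E *ᵥ x) ⬝ᵥ (E *ᵥ x)))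
        linarith [hsqrt x hx])
      (fun x hx => by
        rw [dotProduct_mul_transpose_mulVec, dotProduct_transpose_mul_mulVec]
        have h0 := mul_nonneg (real_dotProduct_self_nonneg (Dᵀ *ᵥ x))
          (real_dotProduct_self_nonneg (E *ᵥ x))
        nlinarith [hsqrt x hx, Real.sq_sqrt h0, Real.sqrt_nonneg
          (((Dᵀ *ᵥ x) ⬝ᵥ (Dᵀ *ᵥ x)) * ((E *ᵥ x) ⬝ᵥ (E *ᵥ x)))])
    refine ⟨ε, hε, fun x hx => ?_⟩
    have hx' := hneg x hx
    rw [dotProduct_mul_transpose_mulVec, dotProduct_transpose_mul_mulVec] at hx'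
    refine lt_of_mul_lt_mul_left ?_ hε.le
    rw [mul_add, mul_inv_cancel_left₀ hε.ne']
    linarith
  · rintro ⟨ε, hε, h⟩ F hF x hx
    linarith [h x hx, two_mul_dotProduct_mulVec_le hF hε (Dᵀ *ᵥ x) (E *ᵥ x)]
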